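/- Main convergence theorem for the parallel subgradient method with line search: Under the same hypotheses on H, C, f_i, subgradient bounds M_i, and step-range conditions (∑ λ̄_n = ∞, ∑ λ̄_n² < ∞, λ̲_n/λ̄_n → 1, ∑(λ̄_n − λ̲_n) < ∞), define x_1 ∈ C and x_{n+1} := (1/K) ∑_{i=1}^K P_C(x_n − λ_{n,i} g_{n,i}) with g_{n,i} ∈ ∂f_i(x_n) and λ_{n,i} ∈ [λ̲_n, λ̄_n]. Then {x_n} converges weakly to a minimizer of ∑_i f_i over C. -/

import Mathlib

open Filter Topology Finset InnerProductSpace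

/-- Weak convergence of a sequence in a real inner product space. -/
def WeakConv {H : Type*} [NormedAddCommGroup H] [InnerProductSpace ℝ H]
    (x : ℕ → H) (p : H) : Prop :=
  ∀ y : H, Tendsto (fun n => ⟪x n, y⟫_ℝ) atTop (𝓝 ⟪p, y⟫_ℝ)

/-- `g` is a subgradient of `f` at `x`. -/
def IsSubgrad {H : Type*} [NormedAddCommGroup H] [InnerProductSpace ℝ H]
    (f : H → ℝ) (x g : H) : Prop :=
  ∀ z : H, f x + ⟪z - x, g⟫_ℝ ≤ f z

/-- A nonnegative sequence that decreases up to summable errors converges, and its decrements are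
summable. -/
theorem summable_and_tendsto_of_le_sub_add {a b e : ℕ → ℝ} (ha : ∀ n, 0 ≤ a n)
    (hb : ∀ n, 0 ≤ b n) (he0 : ∀ n, 0 ≤ e n) (he : Summable e)
    (h : ∀ n, a (n + 1) ≤ a n - b n + e n) :
    Summable b ∧ ∃ l, Tendsto a atTop (𝓝 l) := by
  have hle : ∀ n, ∑ k ∈ range n, e k ≤ ∑' k, e k := fun n => he.sum_le_tsum _ fun i _ => he0 i
  have hsum : ∀ n, a n + ∑ k ∈ range n, b k - ∑ k ∈ range n, e k ≤ a 0 := by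
    intro n
    induction n with
    | zero => simp
    | succ n ih =>
      rw [sum_range_succ, sum_range_succ]
      linarith [h n]
  have hbs : Summable b := summable_of_sum_range_le (c := a 0 + ∑' k, e k) hb fun n => by
    linarith [hsum n, hle n, ha n]
  refine ⟨hbs, ?_⟩
  have hanti : Antitone fun n => a n + ∑ k ∈ range n, b k - ∑ k ∈ range n, e k :=
    antitone_nat_of_succ_le fun n => by
      rw [sum_range_succ, sum_range_succ]
      linarith [h n]
  have hbdd : BddBelow (Set.range fun n => a n + ∑ k ∈ range n, b k - ∑ k ∈ range n, e k) := by
    refine ⟨-∑' k, e k, ?_⟩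
    rintro _ ⟨n, rfl⟩
    have := sum_nonneg fun k (_ : k ∈ range n) => hb k
    show _ ≤ a n + ∑ k ∈ range n, b k - ∑ k ∈ range n, e k
    linarith [hle n, ha n]
  refine ⟨_, (((tendsto_atTop_ciInf hanti hbdd).sub hbs.hasSum.tendsto_sum_nat).add
    he.hasSum.tendsto_sum_nat).congr fun n => ?_⟩
  ring

/-- If `∑ h = ∞` and `∑ h δ < ∞`, and `δ` increases by at most a multiple of `h` at each step,
then `δ` tends to zero. -/
theorem tendsto_zero_of_summable_mul {h δ : ℕ → ℝ} {c : ℝ} (hh : ∀ n, 0 ≤ h n)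
    (hδ : ∀ n, 0 ≤ δ n) (hc : 0 ≤ c) (hdiv : ¬ Summable h) (hsq : Summable fun n => h n ^ 2)
    (hmul : Summable fun n => h n * δ n) (hstep : ∀ n, δ (n + 1) ≤ δ n + c * h n) :
    Tendsto δ atTop (𝓝 0) := by
  obtain ⟨-, l, hl⟩ := summable_and_tendsto_of_le_sub_add (a := fun n => δ n ^ 2) (b := 0)
    (e := fun n => 2 * c * (h n * δ n) + c ^ 2 * h n ^ 2) (fun n => sq_nonneg _)
    (fun n => le_rfl)
    (fun n => by have := hh n; have := hδ n; positivity)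
    ((hmul.mul_left _).add (hsq.mul_left _))
    (fun n => by
      have := pow_le_pow_left₀ (hδ (n + 1)) (hstep n) 2
      simp only [Pi.zero_apply]
      linarith)
  have hlim : Tendsto δ atTop (𝓝 √l) :=
    hl.sqrt.congr fun n => Real.sqrt_sq (hδ n)
  rcases (Real.sqrt_nonneg l).eq_or_lt with h0 | hpos
  · rwa [h0]
  · refine absurd ?_ hdiv
    refine Summable.of_norm_bounded_eventually_nat (hmul.mul_left (2 / √l)) ?_
    filter_upwards [hlim.eventually (lt_mem_nhds (half_lt_self hpos))] with n hn
    rw [Real.norm_of_nonneg (hh n)]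
    calc h n = 2 / √l * (h n * (√l / 2)) := by field_simp
      _ ≤ 2 / √l * (h n * δ n) := by gcongr; exact hh n

theorem convexOn_finset_sum {E ι : Type*} [AddCommGroup E] [Module ℝ E] {S : Set E}
    (hS : Convex ℝ S) (s : Finset ι) {f : ι → E → ℝ} (hf : ∀ i ∈ s, ConvexOn ℝ S (f i)) :
    ConvexOn ℝ S fun x => ∑ i ∈ s, f i x := by
  classical
  induction s using Finset.induction_on with
  | empty => simpa using convexOn_const (0 : ℝ) hS
  | insert i s hi ih =>
    simp only [sum_insert hi]
    exact (hf i (mem_insert_self i s)).add (ih fun j hj => hf j (mem_insert_of_mem hj))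

section InnerProduct

variable {H : Type*} [NormedAddCommGroup H] [InnerProductSpace ℝ H]

theorem norm_sub_le_of_forall_norm_sub_le {C : Set H} (hC : Convex ℝ C) {u p y : H} (hp : p ∈ C)
    (hmin : ∀ z ∈ C, ‖u - p‖ ≤ ‖u - z‖) (hy : y ∈ C) : ‖p - y‖ ≤ ‖u - y‖ := by
  have hne : Nonempty C := ⟨⟨p, hp⟩⟩
  have hinf : ‖u - p‖ = ⨅ w : C, ‖u - w‖ :=
    le_antisymm (le_ciInf fun w => hmin w w.2)
      (ciInf_le ⟨0, by rintro _ ⟨w, rfl⟩; exact norm_nonneg _⟩ (⟨p, hp⟩ : C))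
  have hin := (norm_eq_iInf_iff_real_inner_le_zero hC hp).1 hinf y hy
  have hexp : ‖u - y‖ ^ 2 = ‖u - p‖ ^ 2 - 2 * ⟪u - p, y - p⟫_ℝ + ‖y - p‖ ^ 2 := by
    rw [← norm_sub_sq_real, sub_sub_sub_cancel_right]
  rw [norm_sub_rev p y]
  refine le_of_sq_le_sq ?_ (norm_nonneg _)
  nlinarith [sq_nonneg ‖u - p‖]

theorem norm_average_sub_le {ι : Type*} {s : Finset ι} (hs : s.Nonempty) (v : ι → H) (y : H) :
    ‖(s.card : ℝ)⁻¹ • ∑ i ∈ s, v i - y‖ ≤ (s.card : ℝ)⁻¹ * ∑ i ∈ s, ‖v i - y‖ := by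
  have hc : (s.card : ℝ) ≠ 0 := by exact_mod_cast hs.card_pos.ne'
  have : (s.card : ℝ)⁻¹ • ∑ i ∈ s, v i - y = (s.card : ℝ)⁻¹ • ∑ i ∈ s, (v i - y) := by
    rw [sum_sub_distrib, sum_const, smul_sub, ← Nat.cast_smul_eq_nsmul ℝ, inv_smul_smul₀ hc]
  rw [this, norm_smul, Real.norm_of_nonneg (by positivity)]
  gcongr
  exact norm_sum_le _ _

theorem norm_average_sub_sq_le {ι : Type*} {s : Finset ι} (hs : s.Nonempty) (v : ι → H) (y : H) :
    ‖(s.card : ℝ)⁻¹ • ∑ i ∈ s, v i - y‖ ^ 2 ≤ (s.card : ℝ)⁻¹ * ∑ i ∈ s, ‖v i - y‖ ^ 2 := by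
  have hc : (s.card : ℝ) ≠ 0 := by exact_mod_cast hs.card_pos.ne'
  calc _ ≤ ((s.card : ℝ)⁻¹ * ∑ i ∈ s, ‖v i - y‖) ^ 2 :=
        pow_le_pow_left₀ (norm_nonneg _) (norm_average_sub_le hs v y) 2
    _ = (s.card : ℝ)⁻¹ ^ 2 * (∑ i ∈ s, ‖v i - y‖) ^ 2 := mul_pow _ _ _
    _ ≤ (s.card : ℝ)⁻¹ ^ 2 * (s.card * ∑ i ∈ s, ‖v i - y‖ ^ 2) := by
        gcongr
        exact sq_sum_le_card_mul_sum_sq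
    _ = _ := by field_simp

theorem average_mem {ι : Type*} {C : Set H} (hC : Convex ℝ C) {s : Finset ι} (hs : s.Nonempty)
    {v : ι → H} (hv : ∀ i ∈ s, v i ∈ C) : (s.card : ℝ)⁻¹ • ∑ i ∈ s, v i ∈ C := by
  have hc : (s.card : ℝ) ≠ 0 := by exact_mod_cast hs.card_pos.ne'
  rw [smul_sum]
  exact hC.sum_mem (fun _ _ => by positivity) (by simp [hc]) hv

theorem IsSubgrad.norm_sub_smul_sub_sq_le {f : H → ℝ} {x g : H} (hg : IsSubgrad f x g) {t : ℝ}
    (ht : 0 ≤ t) (y : H) :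
    ‖x - t • g - y‖ ^ 2 ≤ ‖x - y‖ ^ 2 - 2 * (t * (f x - f y)) + t ^ 2 * ‖g‖ ^ 2 := by
  have hexp : ‖x - t • g - y‖ ^ 2 = ‖x - y‖ ^ 2 - 2 * (t * ⟪x - y, g⟫_ℝ) + t ^ 2 * ‖g‖ ^ 2 := by
    rw [sub_right_comm, norm_sub_sq_real, real_inner_smul_right, norm_smul, mul_pow,
      Real.norm_eq_abs, sq_abs]
  have hy := hg y
  rw [← neg_sub x y, inner_neg_left] at hy
  have := mul_le_mul_of_nonneg_left (show f x - f y ≤ ⟪x - y, g⟫_ℝ by linarith) ht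
  linarith

theorem IsSubgrad.sub_le {f : H → ℝ} {x g : H} (hg : IsSubgrad f x g) (y : H) :
    f x - f y ≤ ‖y - x‖ * ‖g‖ := by
  have := hg y
  have := neg_le_of_abs_le (abs_real_inner_le_norm (y - x) g)
  linarith

variable [CompleteSpace H]

theorem exists_weak_limit_ultrafilter {ι : Type*} (U : Ultrafilter ι) {x : ι → H} {R : ℝ}
    (hx : ∀ n, ‖x n‖ ≤ R) :
    ∃ p : H, ∀ y : H, Tendsto (fun n => ⟪x n, y⟫_ℝ) U (𝓝 ⟪p, y⟫_ℝ) := by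
  let φ : ι → WeakDual ℝ H := fun n => StrongDual.toWeakDual (InnerProductSpace.toDual ℝ H (x n))
  obtain ⟨q, -, hq⟩ := (WeakDual.isCompact_closedBall (𝕜 := ℝ) (0 : StrongDual ℝ H)
    R).ultrafilter_le_nhds (U.map φ) (by
      rw [Ultrafilter.coe_map, le_principal_iff]
      refine Filter.mem_map.2 (Filter.univ_mem' fun n => ?_)
      simpa [φ] using hx n)
  refine ⟨(InnerProductSpace.toDual ℝ H).symm (WeakDual.toStrongDual q), fun y => ?_⟩
  rw [InnerProductSpace.toDual_symm_apply]
  have hq' : Tendsto φ U (𝓝 q) := hq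
  exact ((WeakDual.eval_continuous y).tendsto q).comp hq'

theorem mem_of_weak_limit {ι : Type*} {l : Filter ι} [l.NeBot] {x : ι → H} {p : H}
    (hp : ∀ y : H, Tendsto (fun n => ⟪x n, y⟫_ℝ) l (𝓝 ⟪p, y⟫_ℝ)) {S : Set H}
    (hcl : IsClosed S) (hcv : Convex ℝ S) (hS : ∀ᶠ n in l, x n ∈ S) : p ∈ S := by
  obtain ⟨q, hqS, hq⟩ := exists_norm_eq_iInf_of_complete_convex
    (hS.exists.elim fun n hn => ⟨x n, hn⟩) hcl.isComplete hcv p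
  have hq' := (norm_eq_iInf_iff_real_inner_le_zero hcv hqS).1 hq
  have hle : ⟪p, p - q⟫_ℝ ≤ ⟪q, p - q⟫_ℝ := by
    refine le_of_tendsto (hp (p - q)) (hS.mono fun n hn => ?_)
    have := hq' _ hn
    rw [inner_sub_right, real_inner_comm, real_inner_comm q] at this
    linarith
  have : ⟪p - q, p - q⟫_ℝ ≤ 0 := by rw [inner_sub_left]; linarith
  rw [real_inner_self_nonpos] at this
  rwa [sub_eq_zero.1 this]

/-- Opial's argument: if the distances to every point of `S` converge and all weak cluster points
lie in `S`, then the sequence converges weakly to a point of `S`. -/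
theorem exists_weakConv_of_tendsto_norm_sub_sq {x : ℕ → H} {S : Set H} (hne : S.Nonempty)
    (hlim : ∀ y ∈ S, ∃ l, Tendsto (fun n => ‖x n - y‖ ^ 2) atTop (𝓝 l))
    (hclus : ∀ (U : Ultrafilter ℕ) (p : H), (U : Filter ℕ) ≤ atTop →
      (∀ y : H, Tendsto (fun n => ⟪x n, y⟫_ℝ) U (𝓝 ⟪p, y⟫_ℝ)) → p ∈ S) :
    ∃ u ∈ S, WeakConv x u := by
  obtain ⟨R, hR⟩ : ∃ R, ∀ n, ‖x n‖ ≤ R := by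
    obtain ⟨y, hy⟩ := hne
    obtain ⟨l, hl⟩ := hlim y hy
    obtain ⟨B, hB⟩ := hl.bddAbove_range
    refine ⟨√B + ‖y‖, fun n => ?_⟩
    have h1 : ‖x n - y‖ ≤ √B := Real.le_sqrt_of_sq_le (hB ⟨n, rfl⟩)
    linarith [norm_le_norm_sub_add (x n) y]
  choose p hp using fun U : Ultrafilter ℕ => exists_weak_limit_ultrafilter U hR
  have huniq : ∀ U V : Ultrafilter ℕ, (U : Filter ℕ) ≤ atTop → (V : Filter ℕ) ≤ atTop →
      p U = p V := by
    intro U V hU hV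
    obtain ⟨a, ha⟩ := hlim _ (hclus U _ hU (hp U))
    obtain ⟨b, hb⟩ := hlim _ (hclus V _ hV (hp V))
    have hinner : Tendsto (fun n => ⟪x n, p U - p V⟫_ℝ) atTop
        (𝓝 ((b - a + ‖p U‖ ^ 2 - ‖p V‖ ^ 2) / 2)) := by
      refine ((((hb.sub ha).add_const _).sub_const _).div_const 2).congr fun n => ?_
      rw [norm_sub_sq_real, norm_sub_sq_real, inner_sub_right]
      ring
    have h1 := tendsto_nhds_unique (hp U (p U - p V)) (hinner.mono_left hU)
    have h2 := tendsto_nhds_unique (hp V (p U - p V)) (hinner.mono_left hV)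
    have : ⟪p U - p V, p U - p V⟫_ℝ = 0 := by rw [inner_sub_left, h1, h2, sub_self]
    exact sub_eq_zero.1 (inner_self_eq_zero.1 this)
  obtain ⟨V, h0⟩ := Ultrafilter.exists_le (atTop : Filter ℕ)
  refine ⟨p V, hclus _ _ h0 (hp _), fun y => ?_⟩
  rw [tendsto_iff_ultrafilter]
  intro U hU
  rw [huniq V U h0 hU]
  exact hp U y

end InnerProduct

theorem parallel_subgradient_method_weak_convergence {H : Type*} [NormedAddCommGroup H]
    [InnerProductSpace ℝ H] [CompleteSpace H]
    (C : Set H) (hCne : C.Nonempty) (hCcl : IsClosed C) (hCcv : Convex ℝ C)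
    (P : H → H) (hP : ∀ u : H, P u ∈ C ∧ ∀ z ∈ C, ‖u - P u‖ ≤ ‖u - z‖)
    (K : ℕ) (hK : 0 < K)
    (f : ℕ → H → ℝ) (hfnn : ∀ i x, 0 ≤ f i x)
    (hfconv : ∀ i, ConvexOn ℝ Set.univ (f i)) (hfcont : ∀ i, Continuous (f i))
    (Mi : ℕ → ℝ) (hMi : ∀ i, 0 < Mi i)
    (hbdd : ∀ i, 1 ≤ i → i ≤ K → ∀ x ∈ C, ∀ g : H, IsSubgrad (f i) x g → ‖g‖ ≤ Mi i)
    (hargmin : ∃ yhat ∈ C, ∀ z ∈ C,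
      ∑ i ∈ Finset.Icc 1 K, f i yhat ≤ ∑ i ∈ Finset.Icc 1 K, f i z)
    (lo hi : ℕ → ℝ) (hlo : ∀ n, 0 < lo n) (hlohi : ∀ n, lo n ≤ hi n)
    (hdiv : ¬ Summable hi) (hsq : Summable (fun n => hi n ^ 2))
    (hratio : Tendsto (fun n => lo n / hi n) atTop (𝓝 1))
    (hgap : Summable (fun n => hi n - lo n))
    (lam : ℕ → ℕ → ℝ) (hlam : ∀ n i, 1 ≤ i → i ≤ K → lam n i ∈ Set.Icc (lo n) (hi n))
    (g : ℕ → ℕ → H) (x : ℕ → H)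
    (hx0 : x 0 ∈ C)
    (hg : ∀ n, ∀ i, 1 ≤ i → i ≤ K → IsSubgrad (f i) (x n) (g n i))
    (hxn : ∀ n, x (n + 1) = (K : ℝ)⁻¹ • ∑ i ∈ Finset.Icc 1 K, P (x n - lam n i • g n i)) :
    ∃ u : H, u ∈ C ∧
      (∀ z ∈ C, ∑ i ∈ Finset.Icc 1 K, f i u ≤ ∑ i ∈ Finset.Icc 1 K, f i z) ∧
      WeakConv x u := by
  set s : Finset ℕ := Icc 1 K with hs_def
  have hmem : ∀ {i}, i ∈ s → 1 ≤ i ∧ i ≤ K := fun hi => mem_Icc.1 hi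
  have hcard : s.card = K := by simp [hs_def]
  have hs : s.Nonempty := card_pos.1 (hcard.symm ▸ hK)
  have hKpos : (0 : ℝ) < K := by exact_mod_cast hK
  rw [← hcard] at hxn hKpos
  have hxC : ∀ n, x n ∈ C := by
    intro n
    cases n with
    | zero => exact hx0
    | succ n => exact hxn n ▸ average_mem hCcv hs fun i _ => (hP _).1
  have hhi : ∀ n, 0 ≤ hi n := fun n => (hlo n).le.trans (hlohi n)
  have hlam0 : ∀ n, ∀ i ∈ s, 0 ≤ lam n i := fun n i hi' =>
    (hlo n).le.trans (hlam n i (hmem hi').1 (hmem hi').2).1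
  have hsub : ∀ n, ∀ i ∈ s, IsSubgrad (f i) (x n) (g n i) := fun n i hi' =>
    hg n i (hmem hi').1 (hmem hi').2
  have hgM : ∀ n, ∀ i ∈ s, ‖g n i‖ ≤ Mi i := fun n i hi' =>
    hbdd i (hmem hi').1 (hmem hi').2 _ (hxC n) _ (hsub n i hi')
  have hproj : ∀ u, ∀ y ∈ C, ‖P u - y‖ ≤ ‖u - y‖ := fun u y hy =>
    norm_sub_le_of_forall_norm_sub_le hCcv (hP u).1 (hP u).2 hy
  let F : H → ℝ := fun z => ∑ i ∈ s, f i z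
  set M : ℝ := ∑ i ∈ s, Mi i with hM_def
  set Q : ℝ := ∑ i ∈ s, Mi i ^ 2 with hQ_def
  have hM0 : 0 ≤ M := sum_nonneg fun i _ => (hMi i).le
  have hQ0 : 0 ≤ Q := sum_nonneg fun i _ => sq_nonneg _
  have hF0 : ∀ z, 0 ≤ F z := fun z => sum_nonneg fun i _ => hfnn i z
  have hdescent : ∀ y ∈ C, ∀ n, ‖x (n + 1) - y‖ ^ 2 ≤ ‖x n - y‖ ^ 2
      - 2 * (s.card : ℝ)⁻¹ * (lo n * (F (x n) - F y))
      + (s.card : ℝ)⁻¹ * (2 * F y * (hi n - lo n) + Q * hi n ^ 2) := by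
    intro y hy n
    have hterm : ∀ i ∈ s, ‖P (x n - lam n i • g n i) - y‖ ^ 2 ≤ ‖x n - y‖ ^ 2
        - 2 * (lo n * f i (x n) - hi n * f i y) + hi n ^ 2 * Mi i ^ 2 := by
      intro i hi'
      have hl := hlam n i (hmem hi').1 (hmem hi').2
      have h1 := pow_le_pow_left₀ (norm_nonneg _) (hproj (x n - lam n i • g n i) y hy) 2
      have h2 := (hsub n i hi').norm_sub_smul_sub_sq_le (hlam0 n i hi') y
      have h3 : lam n i ^ 2 * ‖g n i‖ ^ 2 ≤ hi n ^ 2 * Mi i ^ 2 :=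
        mul_le_mul (pow_le_pow_left₀ (hlam0 n i hi') hl.2 2)
          (pow_le_pow_left₀ (norm_nonneg _) (hgM n i hi') 2) (sq_nonneg _) (sq_nonneg _)
      have h4 := mul_le_mul_of_nonneg_right hl.1 (hfnn i (x n))
      have h5 := mul_le_mul_of_nonneg_right hl.2 (hfnn i y)
      linarith
    rw [hxn n]
    refine (norm_average_sub_sq_le hs _ y).trans
      ((mul_le_mul_of_nonneg_left (sum_le_sum hterm) (by positivity)).trans_eq ?_)
    simp only [sum_add_distrib, sum_sub_distrib, sum_const, nsmul_eq_mul, ← mul_sum, F, hQ_def]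
    field_simp
    ring
  have hmove : ∀ n, ‖x (n + 1) - x n‖ ≤ M * hi n := by
    intro n
    have hterm : ∀ i ∈ s, ‖P (x n - lam n i • g n i) - x n‖ ≤ M * hi n := by
      intro i hi'
      have hl := hlam n i (hmem hi').1 (hmem hi').2
      refine (hproj _ _ (hxC n)).trans ?_
      rw [sub_sub_cancel_left, norm_neg, norm_smul, Real.norm_of_nonneg (hlam0 n i hi'), mul_comm]
      exact mul_le_mul ((hgM n i hi').trans (single_le_sum (fun j _ => (hMi j).le) hi')) hl.2
        (hlam0 n i hi') hM0
    rw [hxn n]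
    refine (norm_average_sub_le hs _ _).trans
      ((mul_le_mul_of_nonneg_left (sum_le_sum hterm) (by positivity)).trans_eq ?_)
    rw [sum_const, nsmul_eq_mul]
    field_simp
  have hFstep : ∀ n, F (x (n + 1)) ≤ F (x n) + M * M * hi n := by
    intro n
    have hterm : ∀ i ∈ s, f i (x (n + 1)) ≤ f i (x n) + M * hi n * Mi i := by
      intro i hi'
      have h1 := (hsub (n + 1) i hi').sub_le (x n)
      rw [norm_sub_rev] at h1
      have h2 := mul_le_mul (hmove n) (hgM (n + 1) i hi') (norm_nonneg _)
        (mul_nonneg hM0 (hhi n))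
      linarith
    refine (sum_le_sum hterm).trans_eq ?_
    rw [sum_add_distrib, ← mul_sum, ← hM_def]
    ring
  have hfejer : ∀ y ∈ C, (∀ z ∈ C, F y ≤ F z) →
      Summable (fun n => 2 * (s.card : ℝ)⁻¹ * (lo n * (F (x n) - F y))) ∧
        ∃ l, Tendsto (fun n => ‖x n - y‖ ^ 2) atTop (𝓝 l) := by
    intro y hy hmin
    refine summable_and_tendsto_of_le_sub_add (fun n => sq_nonneg _) (fun n => ?_) (fun n => ?_)
      (((hgap.mul_left (2 * F y)).add (hsq.mul_left Q)).mul_left _) (hdescent y hy)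
    · have := sub_nonneg.2 (hmin _ (hxC n))
      have := hlo n
      positivity
    · have := sub_nonneg.2 (hlohi n)
      have := hF0 y
      positivity
  obtain ⟨y, hy, hymin⟩ := hargmin
  have hFlim : Tendsto (fun n => F (x n) - F y) atTop (𝓝 0) := by
    have hgapF : ∀ n, 0 ≤ F (x n) - F y := fun n => sub_nonneg.2 (hymin _ (hxC n))
    refine tendsto_zero_of_summable_mul (c := M * M) hhi hgapF (mul_nonneg hM0 hM0) hdiv hsq ?_
      fun n => by linarith [hFstep n]
    refine Summable.of_norm_bounded_eventually_nat
      ((hfejer y hy hymin).1.mul_left (s.card : ℝ)) ?_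
    filter_upwards [hratio.eventually (lt_mem_nhds (show (1 / 2 : ℝ) < 1 by norm_num))] with n hn
    have hpos : 0 < hi n := (hlo n).trans_le (hlohi n)
    rw [lt_div_iff₀ hpos] at hn
    rw [Real.norm_of_nonneg (mul_nonneg (hhi n) (hgapF n))]
    calc hi n * (F (x n) - F y) ≤ 2 * lo n * (F (x n) - F y) :=
          mul_le_mul_of_nonneg_right (by linarith) (hgapF n)
      _ = _ := by field_simp
  have hFcv : ConvexOn ℝ Set.univ F := convexOn_finset_sum convex_univ s fun i _ => hfconv i
  have hFcont : Continuous F := continuous_finsetSum s fun i _ => hfcont i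
  obtain ⟨u, ⟨huC, humin⟩, hu⟩ := exists_weakConv_of_tendsto_norm_sub_sq (x := x)
    (S := {z | z ∈ C ∧ ∀ w ∈ C, F z ≤ F w}) ⟨y, hy, hymin⟩ (fun z hz => (hfejer z hz.1 hz.2).2)
    (by
      intro U p hU hp
      refine ⟨mem_of_weak_limit hp hCcl hCcv (Eventually.of_forall hxC), fun w hw => ?_⟩
      refine le_trans (le_of_forall_pos_le_add fun ε hε => ?_) (hymin w hw)
      have hcv := hFcv.convex_le (F y + ε)
      refine (mem_of_weak_limit hp (S := {z | z ∈ Set.univ ∧ F z ≤ F y + ε}) ?_ hcv ?_).2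
      · simpa using isClosed_le hFcont continuous_const
      · filter_upwards [(hFlim.mono_left hU).eventually (gt_mem_nhds hε)] with n hn
        exact ⟨Set.mem_univ _, by linarith⟩)
  exact ⟨u, huC, humin, hu⟩
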